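/- arXiv:2509.16234 — 2 statements merged into one kernel-verified Lean document; each statement's English description precedes it below -/
import Mathlib

section
/- Let p be a prime, n ≥ 1, f ∈ ℤ[X], and let v ∈ ZMod p^n be a periodic point of F_{p^n} of minimal period k with λ̄(v) = 1 in ZMod p. Then for every vertex w of the cycle of v (i.e., w = F_{p^n}^l(v) for some l), one has r_v = 0 if and only if r_w = 0. -/
/-- The map on `ZMod m` induced by a polynomial `f ∈ ℤ[X]`. -/
noncomputable def polyMap (m : ℕ) (f : Polynomial ℤ) : ZMod m → ZMod m :=
  fun x => Polynomial.aeval x f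

/-- The multiplier `λ(v) = ∏_{i=0}^{k-1} f'(F_m^i(v)) ∈ ZMod m` of a periodic point `v`
of minimal period `k`. -/
noncomputable def multiplier (m : ℕ) (f : Polynomial ℤ) (k : ℕ) (v : ZMod m) : ZMod m :=
  ∏ i ∈ Finset.range k, Polynomial.aeval ((polyMap m f)^[i] v) (Polynomial.derivative f)

/-- `f^{∘k} : ℤ → ℤ`, the `k`-fold iterate of the polynomial map of `f`. -/
noncomputable def polyIter (f : Polynomial ℤ) (k : ℕ) : ℤ → ℤ :=
  (fun x : ℤ => Polynomial.eval x f)^[k]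

lemma intCast_polyIter (m : ℕ) (f : Polynomial ℤ) (i : ℕ) (x : ℤ) :
    ((polyIter f i x : ℤ) : ZMod m) = (polyMap m f)^[i] (x : ZMod m) := by
  induction i with
  | zero => rfl
  | succ i ih =>
    rw [Function.iterate_succ_apply', ← ih]
    simp only [polyIter, polyMap, Function.iterate_succ_apply']
    exact (Polynomial.aeval_algebraMap_apply_eq_algebraMap_eval (A := ZMod m) _ f).symm

lemma polyIter_add (f : Polynomial ℤ) (i j : ℕ) (x : ℤ) :
    polyIter f (i + j) x = polyIter f i (polyIter f j x) :=
  Function.iterate_add_apply _ i j x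

/-- First-order Taylor expansion of the iterates of a polynomial map. -/
lemma polyIter_taylor (f : Polynomial ℤ) (k : ℕ) (x h : ℤ) :
    ∃ c : ℤ, polyIter f k (x + h) = polyIter f k x +
      (∏ i ∈ Finset.range k, Polynomial.eval (polyIter f i x) (Polynomial.derivative f)) * h +
      c * h ^ 2 := by
  induction k with
  | zero => exact ⟨0, by simp [polyIter]⟩
  | succ k ih =>
    obtain ⟨c, hc⟩ := ih
    set P := ∏ i ∈ Finset.range k, Polynomial.eval (polyIter f i x) (Polynomial.derivative f)
    obtain ⟨d, hd⟩ := f.binomExpansion (polyIter f k x) (P * h + c * h ^ 2)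
    refine ⟨Polynomial.eval (polyIter f k x) (Polynomial.derivative f) * c +
      d * (P + c * h) ^ 2, ?_⟩
    have hs (y : ℤ) : polyIter f (k + 1) y = Polynomial.eval (polyIter f k y) f :=
      Function.iterate_succ_apply' _ k y
    rw [hs, hs, hc, Finset.prod_range_succ, add_assoc (polyIter f k x), hd]
    ring

lemma sub_dvd_polyIter_sub (f : Polynomial ℤ) (k : ℕ) (x y : ℤ) :
    y - x ∣ polyIter f k y - polyIter f k x := by
  obtain ⟨c, hc⟩ := polyIter_taylor f k x (y - x)
  rw [add_sub_cancel] at hc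
  rw [hc]
  exact ⟨(∏ i ∈ Finset.range k, Polynomial.eval (polyIter f i x) (Polynomial.derivative f)) +
    c * (y - x), by ring⟩

lemma multiplier_intCast (m : ℕ) (f : Polynomial ℤ) (k : ℕ) (x : ℤ) :
    multiplier m f k (x : ZMod m) =
      ((∏ i ∈ Finset.range k,
        Polynomial.eval (polyIter f i x) (Polynomial.derivative f) : ℤ) : ZMod m) := by
  rw [multiplier, Int.cast_prod]
  refine Finset.prod_congr rfl fun i _ => ?_
  rw [← intCast_polyIter]
  exact Polynomial.aeval_algebraMap_apply_eq_algebraMap_eval (A := ZMod m) _ _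

lemma multiplier_iterate {m : ℕ} {f : Polynomial ℤ} {k : ℕ} {v : ZMod m}
    (hk : Function.IsPeriodicPt (polyMap m f) k v) (l : ℕ) :
    multiplier m f k ((polyMap m f)^[l] v) = multiplier m f k v := by
  induction l with
  | zero => rfl
  | succ l ih =>
    rw [← ih, Function.iterate_succ_apply']
    have hu := hk.apply_iterate l
    generalize (polyMap m f)^[l] v = u at hu ⊢
    cases k with
    | zero => simp [multiplier]
    | succ j =>
      rw [multiplier, multiplier, Finset.prod_range_succ, Finset.prod_range_succ']
      simp only [← Function.iterate_succ_apply]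
      rw [hu.eq]
      rfl

/-- If the multiplier is `1` modulo `p`, being fixed by `f^{∘k}` modulo `p ^ (n + 1)` does not
depend on the choice of a lift of `v`. -/
lemma pow_succ_dvd_polyIter_sub_of_lift {p n : ℕ} (hn : n ≠ 0) {f : Polynomial ℤ} {k : ℕ}
    {v : ZMod (p ^ n)}
    (hlam : ZMod.castHom (dvd_pow_self p hn) (ZMod p) (multiplier (p ^ n) f k v) = 1)
    {x y : ℤ} (hx : (x : ZMod (p ^ n)) = v) (hy : (y : ZMod (p ^ n)) = v)
    (h : (p : ℤ) ^ (n + 1) ∣ polyIter f k x - x) :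
    (p : ℤ) ^ (n + 1) ∣ polyIter f k y - y := by
  obtain ⟨t, ht⟩ : (p : ℤ) ^ n ∣ y - x := by
    have := (ZMod.intCast_eq_intCast_iff_dvd_sub x y (p ^ n)).1 (hx.trans hy.symm)
    exact_mod_cast this
  obtain ⟨c, hc⟩ := polyIter_taylor f k x (y - x)
  rw [← hx, multiplier_intCast, map_intCast] at hlam
  set P := ∏ i ∈ Finset.range k, Polynomial.eval (polyIter f i x) (Polynomial.derivative f)
  obtain ⟨s, hs⟩ : (p : ℤ) ∣ P - 1 :=
    (ZMod.intCast_eq_intCast_iff_dvd_sub 1 P p).1 (by rw [hlam, Int.cast_one])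
  have hsq : (p : ℤ) ^ (n + 1) ∣ (y - x) ^ 2 := by
    rw [ht, mul_pow, ← pow_mul]
    exact (pow_dvd_pow _ (by lia)).mul_right _
  have hlin : (p : ℤ) ^ (n + 1) ∣ (P - 1) * (y - x) := ⟨s * t, by rw [hs, ht]; ring⟩
  rw [add_sub_cancel] at hc
  have key : polyIter f k y - y =
      (polyIter f k x - x) + (P - 1) * (y - x) + c * (y - x) ^ 2 := by rw [hc]; ring
  rw [key]
  exact (h.add hlin).add (hsq.mul_left c)

/-- Being fixed by `f^{∘k}` modulo `p ^ (n + 1)` propagates along the orbit of a periodic point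
whose multiplier is `1` modulo `p`. -/
lemma pow_succ_dvd_polyIter_sub_of_iterate {p n : ℕ} (hn : n ≠ 0) {f : Polynomial ℤ} {k : ℕ}
    {v : ZMod (p ^ n)} (hk : Function.IsPeriodicPt (polyMap (p ^ n) f) k v)
    (hlam : ZMod.castHom (dvd_pow_self p hn) (ZMod p) (multiplier (p ^ n) f k v) = 1)
    (l : ℕ) {x y : ℤ} (hx : (x : ZMod (p ^ n)) = v)
    (hy : (y : ZMod (p ^ n)) = (polyMap (p ^ n) f)^[l] v)
    (h : (p : ℤ) ^ (n + 1) ∣ polyIter f k x - x) :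
    (p : ℤ) ^ (n + 1) ∣ polyIter f k y - y := by
  rw [← multiplier_iterate hk l] at hlam
  refine pow_succ_dvd_polyIter_sub_of_lift hn hlam (x := polyIter f l x) ?_ hy ?_
  · rw [intCast_polyIter, hx]
  · rw [← polyIter_add, add_comm k, polyIter_add]
    exact h.trans (sub_dvd_polyIter_sub f l _ _)

lemma eq_zero_iff_pow_succ_dvd {p n r : ℕ} (hp : p ≠ 0) (hr : r < p) {a b : ℤ}
    (h : b ≡ a + (r : ℤ) * (p : ℤ) ^ n [ZMOD (p : ℤ) ^ (n + 1)]) :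
    r = 0 ↔ (p : ℤ) ^ (n + 1) ∣ b - a := by
  have h' : (p : ℤ) ^ (n + 1) ∣ b - a ↔ (p : ℤ) ^ (n + 1) ∣ (r : ℤ) * (p : ℤ) ^ n := by
    rw [dvd_iff_dvd_of_dvd_sub]
    have := h.symm.dvd
    rwa [← sub_sub] at this
  rw [h', pow_succ', mul_dvd_mul_iff_right (by positivity), Int.natCast_dvd_natCast]
  exact ⟨fun h0 => h0 ▸ dvd_zero p, fun hd => Nat.eq_zero_of_dvd_of_lt hd hr⟩

/-- Let `v ∈ ZMod p^n` be a periodic point of `F_{p^n}` of minimal period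
`k` with `λ̄(v) = 1` in `ZMod p`. For every vertex `w = F_{p^n}^l(v)` of the cycle of `v`,
with `r_v, r_w ∈ [0, p)` the quantities determined by
`f^{∘k}(a_v) ≡ a_v + r_v·p^n (mod p^{n+1})` and `f^{∘k}(a_w) ≡ a_w + r_w·p^n (mod p^{n+1})`,
one has `r_v = 0` if and only if `r_w = 0`. -/
theorem r_zero_iff_on_cycle (p : ℕ) (hp : p.Prime) (n : ℕ) (hn : n ≠ 0)
    (f : Polynomial ℤ) (k : ℕ) (v : ZMod (p ^ n))
    (hv : v ∈ Function.periodicPts (polyMap (p ^ n) f))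
    (hk : Function.minimalPeriod (polyMap (p ^ n) f) v = k)
    (hlam : ZMod.castHom (dvd_pow_self p hn) (ZMod p) (multiplier (p ^ n) f k v) = 1)
    (l : ℕ) (w : ZMod (p ^ n)) (hw : w = (polyMap (p ^ n) f)^[l] v)
    (r : ℕ) (hrp : r < p)
    (hr : polyIter f k (v.val : ℤ) ≡
      (v.val : ℤ) + (r : ℤ) * (p : ℤ) ^ n [ZMOD (p : ℤ) ^ (n + 1)])
    (r' : ℕ) (hr'p : r' < p)
    (hr' : polyIter f k (w.val : ℤ) ≡
      (w.val : ℤ) + (r' : ℤ) * (p : ℤ) ^ n [ZMOD (p : ℤ) ^ (n + 1)]) :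
    r = 0 ↔ r' = 0 := by
  have : NeZero (p ^ n) := ⟨pow_ne_zero n hp.ne_zero⟩
  have hper : Function.IsPeriodicPt (polyMap (p ^ n) f) k v :=
    hk ▸ Function.isPeriodicPt_minimalPeriod _ v
  have hkpos : 0 < k := hk ▸ Function.minimalPeriod_pos_of_mem_periodicPts hv
  have hcast (u : ZMod (p ^ n)) : ((u.val : ℤ) : ZMod (p ^ n)) = u := by simp
  have hback : v = (polyMap (p ^ n) f)^[l * k - l] w := by
    rw [hw, ← Function.iterate_add_apply, Nat.sub_add_cancel (Nat.le_mul_of_pos_right l hkpos)]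
    exact (hper.const_mul l).eq.symm
  rw [eq_zero_iff_pow_succ_dvd hp.ne_zero hrp hr, eq_zero_iff_pow_succ_dvd hp.ne_zero hr'p hr']
  constructor
  · exact pow_succ_dvd_polyIter_sub_of_iterate hn hper hlam l (hcast v) ((hcast w).trans hw)
  · refine pow_succ_dvd_polyIter_sub_of_iterate hn (hw ▸ hper.apply_iterate l) ?_ (l * k - l)
      (hcast w) ((hcast v).trans hback)
    rw [hw, multiplier_iterate hper, hlam]
end

section
/- Let p be a prime, f ∈ ℤ[X], and let v ∈ ZMod p be a periodic point of F_p of minimal period k whose multiplier λ̄(v) ∈ ZMod p satisfies λ̄(v) ≠ 0 and λ̄(v) ≠ 1, and let m be the multiplicative order of λ̄(v) in (ZMod p)ˣ. Then for every n ≥ 1: (i) there exists exactly one cycle of size k among the periodic points of F_{p^n} projecting (under ZMod p^n → ZMod p) into the cycle of v, i.e., the set of such periodic points of minimal period k is a single orbit of size k; and (ii) every other periodic point of F_{p^n} projecting into the cycle of v has minimal period k·m·p^j for some integer j ≥ 0. -/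
/-- If `g` scales differences in the fibre of `π` over `v` by elements lying over `μ`,
then `g^[t]` scales them by elements lying over `μ ^ t`. -/
theorem exists_slope_iterate {R K : Type*} [CommRing R] [CommRing K] (π : R →+* K) {v μ : K}
    {g : R → R} (hg : ∀ x, π x = v → π (g x) = v)
    (hs : ∀ x y, π x = v → π y = v → ∃ c, π c = μ ∧ g x - g y = c * (x - y)) (t : ℕ) :
    ∀ x y, π x = v → π y = v → ∃ c, π c = μ ^ t ∧ g^[t] x - g^[t] y = c * (x - y) := by
  induction t with
  | zero => intro x y _ _; exact ⟨1, by simp, by simp⟩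
  | succ t ih =>
    intro x y hx hy
    obtain ⟨c, hc, hxy⟩ := hs x y hx hy
    obtain ⟨d, hd, hxy'⟩ := ih _ _ (hg x hx) (hg y hy)
    refine ⟨d * c, by rw [map_mul, hc, hd, pow_succ], ?_⟩
    rw [Function.iterate_succ_apply, Function.iterate_succ_apply, hxy', hxy, mul_assoc]

theorem map_iterate_mem_fibre {R K : Type*} [CommRing R] [CommRing K] (π : R →+* K) {v : K}
    {g : R → R} (hg : ∀ x, π x = v → π (g x) = v) (t : ℕ) :
    ∀ x, π x = v → π (g^[t] x) = v := by
  induction t with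
  | zero => intro x hx; exact hx
  | succ t ih => intro x hx; exact ih _ (hg x hx)

/-- A self-map of a fibre of `π` with slope different from `1` has a fixed point there. -/
theorem exists_fixedPt_of_slope_ne_one {R K : Type*} [CommRing R] [Finite R] [Field K]
    (π : R →+* K) (hπ : ∀ c, π c ≠ 0 → IsUnit c) {v μ : K} {g : R → R}
    (hg : ∀ x, π x = v → π (g x) = v)
    (hs : ∀ x y, π x = v → π y = v → ∃ c, π c = μ ∧ g x - g y = c * (x - y))
    (hμ : μ ≠ 1) {x₀ : R} (hx₀ : π x₀ = v) : ∃ w, π w = v ∧ g w = w := by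
  let φ : {x // π x = v} → {x // π x = v} := fun x =>
    ⟨x₀ + (g x - x), by rw [map_add, map_sub, hx₀, hg x x.2, x.2, sub_self, add_zero]⟩
  have hφ : Function.Injective φ := by
    intro x y hxy
    obtain ⟨c, hc, hcxy⟩ := hs x y x.2 y.2
    have h1 : x₀ + (g x - x) = x₀ + (g y - y) := congrArg Subtype.val hxy
    have hu : IsUnit (c - 1) := hπ _ (by rw [map_sub, map_one, hc]; exact sub_ne_zero.2 hμ)
    have h2 : (c - 1) * ((x : R) - y) = 0 := by linear_combination h1 - hcxy
    exact Subtype.ext (sub_eq_zero.1 (hu.mul_right_eq_zero.1 h2))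
  obtain ⟨w, hw⟩ := Finite.surjective_of_injective hφ ⟨x₀, hx₀⟩
  have h1 : x₀ + (g w - w) = x₀ := congrArg Subtype.val hw
  exact ⟨w, w.2, by linear_combination h1⟩

/-- Two periodic points in a common fibre coincide if some common period `t` satisfies
`μ ^ t ≠ 1`. -/
theorem eq_of_isPeriodicPt_of_slope_pow_ne_one {R K : Type*} [CommRing R] [Field K]
    (π : R →+* K) (hπ : ∀ c, π c ≠ 0 → IsUnit c) {v μ : K} {g : R → R}
    (hg : ∀ x, π x = v → π (g x) = v)
    (hs : ∀ x y, π x = v → π y = v → ∃ c, π c = μ ∧ g x - g y = c * (x - y))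
    {t : ℕ} (hμ : μ ^ t ≠ 1) {x y : R} (hx : π x = v) (hy : π y = v)
    (hxt : g^[t] x = x) (hyt : g^[t] y = y) : x = y := by
  obtain ⟨c, hc, hcxy⟩ := exists_slope_iterate π hg hs t x y hx hy
  rw [hxt, hyt] at hcxy
  have hu : IsUnit (c - 1) := hπ _ (by rw [map_sub, map_one, hc]; exact sub_ne_zero.2 hμ)
  have h2 : (c - 1) * (x - y) = 0 := by linear_combination -hcxy
  exact sub_eq_zero.1 (hu.mul_right_eq_zero.1 h2)

/-- If `h` has slope `1` on a fibre, then `h^[i] x - x` is `i * (h x - x)` to first order. -/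
theorem dvd_iterate_sub_sub {R K : Type*} [CommRing R] [CommRing K]
    (π : R →+* K) {q : R} (hπ : ∀ c, π c = 0 → q ∣ c) {v : K} {h : R → R}
    (hh : ∀ x, π x = v → π (h x) = v)
    (hs : ∀ x y, π x = v → π y = v → ∃ c, π c = 1 ∧ h x - h y = c * (x - y))
    {x : R} (hx : π x = v) (i : ℕ) :
    q * (h x - x) ∣ h^[i] x - x - i * (h x - x) := by
  induction i with
  | zero => simp
  | succ i ih =>
    obtain ⟨c, hc, hcx⟩ := exists_slope_iterate π hh hs i (h x) x (hh x hx) hx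
    rw [one_pow] at hc
    have hq : q ∣ c - 1 := hπ _ (by rw [map_sub, map_one, hc, sub_self])
    rw [Function.iterate_succ_apply]
    convert dvd_add ih (mul_dvd_mul_right hq (h x - x)) using 1
    push_cast
    linear_combination hcx

theorem pow_dvd_iterate_sub {R K : Type*} [CommRing R] [CommRing K]
    (π : R →+* K) {p : ℕ} (hπ : ∀ c, π c = 0 → (p : R) ∣ c) {v : K} {h : R → R}
    (hh : ∀ x, π x = v → π (h x) = v)
    (hs : ∀ x y, π x = v → π y = v → ∃ c, π c = 1 ∧ h x - h y = c * (x - y))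
    {x : R} (hx : π x = v) (a : ℕ) :
    (p : R) ^ (a + 1) ∣ h^[p ^ a] x - x := by
  induction a with
  | zero =>
    simpa using hπ (h x - x) (by rw [map_sub, hh x hx, hx, sub_self])
  | succ a ih =>
    have key := dvd_iterate_sub_sub π hπ (map_iterate_mem_fibre π hh (p ^ a))
      (by simpa using exists_slope_iterate π hh hs (p ^ a)) hx p
    rw [← Function.iterate_mul, ← pow_succ] at key
    have hp : (p : R) ^ (a + 1 + 1) ∣ (p : R) * (h^[p ^ a] x - x) := by
      rw [pow_succ']; exact mul_dvd_mul_left _ ih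
    exact (dvd_sub_left hp).1 (hp.trans key)

theorem map_polyMap {a b : ℕ} (π : ZMod a →+* ZMod b) (f : Polynomial ℤ) (x : ZMod a) :
    π (polyMap a f x) = polyMap b f (π x) := by
  simp only [polyMap, Polynomial.aeval_def, Polynomial.hom_eval₂]
  congr 1
  exact Subsingleton.elim _ _

theorem map_polyMap_iterate {a b : ℕ} (π : ZMod a →+* ZMod b) (f : Polynomial ℤ) (j : ℕ)
    (x : ZMod a) : π ((polyMap a f)^[j] x) = (polyMap b f)^[j] (π x) :=
  (Function.Semiconj.iterate_right (map_polyMap π f) j) x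

theorem exists_slope_polyMap {a b : ℕ} (π : ZMod a →+* ZMod b) (f : Polynomial ℤ)
    {x y : ZMod a} (hxy : π x = π y) :
    ∃ c, π c = Polynomial.aeval (π y) (Polynomial.derivative f) ∧
      polyMap a f x - polyMap a f y = c * (x - y) := by
  obtain ⟨e, he⟩ := (f.map (algebraMap ℤ (ZMod a))).binomExpansion y (x - y)
  rw [add_sub_cancel, Polynomial.derivative_map, Polynomial.eval_map_algebraMap,
    Polynomial.eval_map_algebraMap, Polynomial.eval_map_algebraMap] at he
  refine ⟨polyMap a (Polynomial.derivative f) y + e * (x - y), ?_, ?_⟩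
  · rw [map_add, map_mul, map_sub, hxy, sub_self, mul_zero, add_zero, map_polyMap]
    rfl
  · simp only [polyMap]
    linear_combination he

/-- The slope of `F^[k]` on the fibre over `v` is the multiplier of `v`. -/
theorem exists_slope_polyMap_iterate {a b : ℕ} (π : ZMod a →+* ZMod b) (f : Polynomial ℤ)
    {v : ZMod b} (k : ℕ) {x y : ZMod a} (hx : π x = v) (hy : π y = v) :
    ∃ c, π c = multiplier b f k v ∧
      (polyMap a f)^[k] x - (polyMap a f)^[k] y = c * (x - y) := by
  induction k with
  | zero => exact ⟨1, by simp [multiplier], by simp⟩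
  | succ k ih =>
    obtain ⟨c, hc, hxy⟩ := ih
    obtain ⟨d, hd, hxy'⟩ := exists_slope_polyMap π f
      (x := (polyMap a f)^[k] x) (y := (polyMap a f)^[k] y)
      (by rw [map_polyMap_iterate, map_polyMap_iterate, hx, hy])
    refine ⟨d * c, ?_, ?_⟩
    · rw [map_mul, hc, hd, map_polyMap_iterate, hy, multiplier, multiplier,
        Finset.prod_range_succ, mul_comm]
    · rw [Function.iterate_succ_apply', Function.iterate_succ_apply', hxy', hxy, mul_assoc]

theorem ZMod.natCast_dvd_of_castHom_eq_zero {p N : ℕ} (h : p ∣ N) (c : ZMod N)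
    (hc : ZMod.castHom h (ZMod p) c = 0) : (p : ZMod N) ∣ c := by
  obtain ⟨z, rfl⟩ := ZMod.intCast_surjective c
  rw [map_intCast, ZMod.intCast_zmod_eq_zero_iff_dvd] at hc
  simpa using (Int.castRingHom (ZMod N)).map_dvd hc

theorem ZMod.isUnit_of_castHom_ne_zero {p n : ℕ} (hp : p.Prime) (hn : n ≠ 0)
    (c : ZMod (p ^ n))
    (hc : ZMod.castHom (dvd_pow_self p hn) (ZMod p) c ≠ 0) : IsUnit c := by
  obtain ⟨z, rfl⟩ := ZMod.intCast_surjective c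
  rw [map_intCast, Ne, ZMod.intCast_zmod_eq_zero_iff_dvd] at hc
  have hcop : IsCoprime z ((p ^ n : ℕ) : ℤ) := by
    push_cast
    exact (((Nat.prime_iff_prime_int.1 hp).coprime_iff_not_dvd).2 hc).symm.pow_right
  obtain ⟨a, b, hab⟩ := hcop
  refine IsUnit.of_mul_eq_one (a : ZMod (p ^ n)) ?_
  have := congrArg (Int.cast : ℤ → ZMod (p ^ n)) hab
  rw [Int.cast_add, Int.cast_mul, Int.cast_mul, Int.cast_natCast, ZMod.natCast_self,
    mul_zero, add_zero, Int.cast_one] at this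
  rw [mul_comm, this]

/-- Let `v ∈ ZMod p` be a periodic point of `F_p` of minimal period `k`
with `λ̄(v) ≠ 0, 1`, and let `m` be the multiplicative order of `λ̄(v)`. Then for every
`n ≥ 1`: (i) the periodic points of `F_{p^n}` of minimal period `k` projecting into the
cycle of `v` form exactly one cycle of size `k` (a single orbit); and (ii) every other
periodic point of `F_{p^n}` projecting into the cycle of `v` has minimal period `k·m·p^j`
for some `j ≥ 0`. -/
theorem successive_lifts_multiplier_general (p : ℕ) (hp : p.Prime) (f : Polynomial ℤ)
    (k : ℕ) (v : ZMod p)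
    (hv : v ∈ Function.periodicPts (polyMap p f))
    (hk : Function.minimalPeriod (polyMap p f) v = k)
    (hlam0 : multiplier p f k v ≠ 0)
    (hlam1 : multiplier p f k v ≠ 1)
    (m : ℕ) (hm : m = orderOf (multiplier p f k v)) :
    ∀ n : ℕ, ∀ hn : n ≠ 0,
      (∃ w : ZMod (p ^ n),
        Function.minimalPeriod (polyMap (p ^ n) f) w = k ∧
        {u : ZMod (p ^ n) |
            (∃ i < k, (polyMap p f)^[i] v =
              ZMod.castHom (dvd_pow_self p hn) (ZMod p) u) ∧
            u ∈ Function.periodicPts (polyMap (p ^ n) f) ∧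
            Function.minimalPeriod (polyMap (p ^ n) f) u = k} =
          {u : ZMod (p ^ n) | ∃ i < k, (polyMap (p ^ n) f)^[i] w = u}) ∧
      (∀ u : ZMod (p ^ n),
        (∃ i < k, (polyMap p f)^[i] v =
          ZMod.castHom (dvd_pow_self p hn) (ZMod p) u) →
        u ∈ Function.periodicPts (polyMap (p ^ n) f) →
        Function.minimalPeriod (polyMap (p ^ n) f) u ≠ k →
        ∃ j : ℕ, Function.minimalPeriod (polyMap (p ^ n) f) u = k * m * p ^ j) := by
  intro n hn
  have : Fact p.Prime := ⟨hp⟩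
  have : NeZero (p ^ n) := ⟨pow_ne_zero n hp.ne_zero⟩
  set π := ZMod.castHom (dvd_pow_self p hn) (ZMod p)
  set F := polyMap (p ^ n) f
  set F₀ := polyMap p f
  set μ := multiplier p f k v
  have hk0 : 0 < k := hk ▸ Function.minimalPeriod_pos_of_mem_periodicPts hv
  have hvk : F₀^[k] v = v := hk ▸ Function.iterate_minimalPeriod
  have hsemi : ∀ j x, π (F^[j] x) = F₀^[j] (π x) := map_polyMap_iterate π f
  have hunit : ∀ c, π c ≠ 0 → IsUnit c := ZMod.isUnit_of_castHom_ne_zero hp hn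
  have hker : ∀ c, π c = 0 → (p : ZMod (p ^ n)) ∣ c :=
    ZMod.natCast_dvd_of_castHom_eq_zero (dvd_pow_self p hn)
  have hg : ∀ x, π x = v → π (F^[k] x) = v := fun x hx => by rw [hsemi, hx, hvk]
  have hs : ∀ x y, π x = v → π y = v → ∃ c, π c = μ ∧ F^[k] x - F^[k] y = c * (x - y) :=
    fun x y hx hy => exists_slope_polyMap_iterate π f k hx hy
  obtain ⟨x₀, hx₀⟩ := ZMod.castHom_surjective (dvd_pow_self p hn) v
  obtain ⟨w, hwv, hw⟩ := exists_fixedPt_of_slope_ne_one π hunit hg hs hlam1 hx₀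
  have hdvd : ∀ u, π u = v → k ∣ Function.minimalPeriod F u := by
    intro u hu
    rw [← hk]
    refine Function.IsPeriodicPt.minimalPeriod_dvd ?_
    change F₀^[_] v = v
    rw [← hu, ← hsemi, Function.iterate_minimalPeriod]
  have hwk : Function.minimalPeriod F w = k :=
    Nat.dvd_antisymm (Function.IsPeriodicPt.minimalPeriod_dvd hw) (hdvd w hwv)
  have hwper : w ∈ Function.periodicPts F := Function.mk_mem_periodicPts hk0 hw
  have hback : ∀ u, ∀ i < k, F₀^[i] v = π u → π (F^[k - i] u) = v := by
    intro u i hi hu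
    rw [hsemi, ← hu, ← Function.iterate_add_apply, Nat.sub_add_cancel hi.le, hvk]
  refine ⟨⟨w, hwk, ?_⟩, ?_⟩
  · ext u
    constructor
    · rintro ⟨⟨i, hi, hiu⟩, -, huk⟩
      have huk' : F^[k] u = u := huk ▸ Function.iterate_minimalPeriod
      refine ⟨i, hi, ?_⟩
      have hfix : F^[k] (F^[k - i] u) = F^[k - i] u := by
        rw [← Function.iterate_add_apply, add_comm, Function.iterate_add_apply, huk']
      have hwu : w = F^[k - i] u :=
        eq_of_isPeriodicPt_of_slope_pow_ne_one π hunit hg hs (t := 1)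
          (by rwa [pow_one]) hwv (hback u i hi hiu) hw hfix
      rw [hwu, ← Function.iterate_add_apply, Nat.add_sub_cancel' hi.le, huk']
    · rintro ⟨i, hi, rfl⟩
      refine ⟨⟨i, hi, by rw [hsemi, hwv]⟩, ?_, ?_⟩
      · refine Function.mk_mem_periodicPts hk0 ?_
        exact Function.IsPeriodicPt.apply_iterate hw i
      · rw [Function.minimalPeriod_apply_iterate hwper, hwk]
  · rintro u' ⟨i, hi, hiu⟩ hper hne
    rw [← Function.minimalPeriod_apply_iterate hper (k - i)] at hne ⊢
    have hpos : 0 < Function.minimalPeriod F (F^[k - i] u') := by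
      rw [Function.minimalPeriod_apply_iterate hper]
      exact Function.minimalPeriod_pos_of_mem_periodicPts hper
    have huv := hback u' i hi hiu
    set u := F^[k - i] u'
    obtain ⟨t, ht⟩ := hdvd u huv
    have hut : (F^[k])^[t] u = u := by
      rw [← Function.iterate_mul, ← ht, Function.iterate_minimalPeriod]
    have hmt : m ∣ t := by
      rw [hm]
      refine orderOf_dvd_of_pow_eq_one (by_contra fun hμt => hne ?_)
      have huw : u = w := eq_of_isPeriodicPt_of_slope_pow_ne_one π hunit hg hs hμt huv hwv hut
        (Function.iterate_fixed hw t)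
      rw [huw, hwk]
    obtain ⟨s, rfl⟩ := hmt
    have hm1 : μ ^ m = 1 := hm ▸ pow_orderOf_eq_one μ
    have hsm := exists_slope_iterate π hg hs m
    rw [hm1] at hsm
    have hp0 := pow_dvd_iterate_sub π hker (map_iterate_mem_fibre π hg m) hsm huv n
    have hz : ((p : ZMod (p ^ n)) ^ (n + 1)) = 0 := by
      rw [pow_succ, ← Nat.cast_pow, ZMod.natCast_self, zero_mul]
    rw [hz, zero_dvd_iff, sub_eq_zero, ← Function.iterate_mul, ← Function.iterate_mul] at hp0
    have hd : k * m * s ∣ k * m * p ^ n := by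
      rw [mul_assoc k m s, ← ht, mul_assoc]
      exact Function.IsPeriodicPt.minimalPeriod_dvd hp0
    rw [ht, ← mul_assoc] at hpos
    obtain ⟨j, -, rfl⟩ := (Nat.dvd_prime_pow hp).1
      (Nat.dvd_of_mul_dvd_mul_left (Nat.pos_of_mul_pos_right hpos) hd)
    exact ⟨j, by rw [ht, mul_assoc]⟩
end
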